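/- The minimum over θ ∈ [0,1] of α(t,θ) is bounded on (t_p,t_i]: in fact min_{θ∈[0,1]} α(t,θ) ≤ (t_i 𝓔̃_p / C₃)² for every t ∈ (t_p,t_i], where C₃ > 0 is a lower bound for ∫₀¹ ∫_{ℝ³} f |v₁| dv dθ on (t_p,t_i] and 𝓔̃_p = lim_{t↓t_p} 𝓔̃(t). -/

import Mathlib

open MeasureTheory Set

noncomputable section

set_option linter.unusedVariables false

/-- the velocity space `ℝ³` -/
abbrev V3 : Type := ℝ × ℝ × ℝ

/-- partial derivative with respect to the time variable `t` -/
def pt (F : ℝ → ℝ → ℝ) : ℝ → ℝ → ℝ := fun t θ => deriv (fun s => F s θ) t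

/-- partial derivative with respect to the space variable `θ` -/
def pθ (F : ℝ → ℝ → ℝ) : ℝ → ℝ → ℝ := fun t θ => deriv (fun x => F t x) θ

/-- time derivative within `Ici tp` (one-sided at the left endpoint `tp`) -/
def ptW (tp : ℝ) (F : ℝ → ℝ → ℝ) : ℝ → ℝ → ℝ :=
  fun t θ => derivWithin (fun s => F s θ) (Set.Ici tp) t

/-- time derivative of the matter distribution function -/
def ptf (f : ℝ → ℝ → V3 → ℝ) (t θ : ℝ) (v : V3) : ℝ := deriv (fun s => f s θ v) t

/-- one-sided time derivative of the matter distribution function -/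
def ptWf (tp : ℝ) (f : ℝ → ℝ → V3 → ℝ) (t θ : ℝ) (v : V3) : ℝ :=
  derivWithin (fun s => f s θ v) (Set.Ici tp) t

/-- `θ`-derivative of the matter distribution function -/
def pθf (f : ℝ → ℝ → V3 → ℝ) (t θ : ℝ) (v : V3) : ℝ := deriv (fun x => f t x v) θ

/-- derivative in the first velocity variable `v₁` -/
def pv1 (g : V3 → ℝ) (v : V3) : ℝ := deriv (fun y => g (y, v.2.1, v.2.2)) v.1

/-- derivative in the second velocity variable `v₂` -/
def pv2 (g : V3 → ℝ) (v : V3) : ℝ := deriv (fun y => g (v.1, y, v.2.2)) v.2.1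

/-- derivative in the third velocity variable `v₃` -/
def pv3 (g : V3 → ℝ) (v : V3) : ℝ := deriv (fun y => g (v.1, v.2.1, y)) v.2.2

/-- the velocity component `v₀ = −√(α e^{2ν−2U} + α v₁² + α e^{2ν−4U} v₂² + α t⁻² e^{2ν} (v₃ − A v₂)²)` -/
def v0 (α ν U A : ℝ → ℝ → ℝ) (t θ : ℝ) (v : V3) : ℝ :=
  - Real.sqrt (α t θ * Real.exp (2 * ν t θ - 2 * U t θ)
    + α t θ * v.1 ^ 2
    + α t θ * Real.exp (2 * ν t θ - 4 * U t θ) * v.2.1 ^ 2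
    + α t θ * (t ^ 2)⁻¹ * Real.exp (2 * ν t θ) * (v.2.2 - A t θ * v.2.1) ^ 2)

/-- `β = ν + (ln α)/2` -/
def betaF (ν α : ℝ → ℝ → ℝ) : ℝ → ℝ → ℝ := fun t θ => ν t θ + Real.log (α t θ) / 2

/-- the energy `𝓔̃(t) = ∫₀¹ ν_t/(√α t) dθ` -/
def Etilde (ν α : ℝ → ℝ → ℝ) (t : ℝ) : ℝ :=
  ∫ θ in (0:ℝ)..1, pt ν t θ / (Real.sqrt (α t θ) * t)

/-- The time derivative of a function that is smooth up to the right endpoint is continuous in the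
space variable at interior times. -/
theorem continuous_pt_of_contDiffOn {F : ℝ → ℝ → ℝ} {a b t : ℝ}
    (hF : ContDiffOn ℝ (⊤ : ℕ∞) (fun p : ℝ × ℝ => F p.1 p.2) (Ioc a b ×ˢ (univ : Set ℝ)))
    (ht : t ∈ Ioo a b) : Continuous (fun θ => pt F t θ) := by
  have hopen : IsOpen (Ioo a b ×ˢ (univ : Set ℝ)) := isOpen_Ioo.prod isOpen_univ
  have hF' := hF.mono (prod_mono_left Ioo_subset_Ioc_self)
  have hfd := hF'.continuousOn_fderiv_of_isOpen hopen (by exact_mod_cast le_top)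
  have hmem : ∀ θ : ℝ, (t, θ) ∈ Ioo a b ×ˢ (univ : Set ℝ) := fun θ => ⟨ht, mem_univ θ⟩
  have heq : (fun θ => pt F t θ)
      = fun θ => fderiv ℝ (fun p : ℝ × ℝ => F p.1 p.2) (t, θ) (1, 0) := by
    funext θ
    have hd : HasFDerivAt (fun p : ℝ × ℝ => F p.1 p.2) _ (t, θ) :=
      ((hF'.contDiffAt (hopen.mem_nhds (hmem θ))).differentiableAt (by simp)).hasFDerivAt
    exact (hd.comp_hasDerivAt t ((hasDerivAt_id t).prodMk (hasDerivAt_const t θ))).deriv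
  rw [heq]
  have hc : Continuous fun θ : ℝ => fderiv ℝ (fun p : ℝ × ℝ => F p.1 p.2) (t, θ) :=
    hfd.comp_continuous (by fun_prop) hmem
  exact hc.clm_apply continuous_const

theorem sqrt_mul_abs_le_abs_v0 {α ν U A : ℝ → ℝ → ℝ} {t θ : ℝ} (hα : 0 ≤ α t θ) (v : V3) :
    Real.sqrt (α t θ) * |v.1| ≤ |v0 α ν U A t θ v| := by
  rw [v0, abs_neg, abs_of_nonneg (Real.sqrt_nonneg _), ← Real.sqrt_sq_eq_abs, ← Real.sqrt_mul hα]
  apply Real.sqrt_le_sqrt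
  have h1 : 0 ≤ α t θ * Real.exp (2 * ν t θ - 2 * U t θ) := by positivity
  have h2 : 0 ≤ α t θ * Real.exp (2 * ν t θ - 4 * U t θ) * v.2.1 ^ 2 := by positivity
  have h3 : 0 ≤ α t θ * (t ^ 2)⁻¹ * Real.exp (2 * ν t θ) * (v.2.2 - A t θ * v.2.1) ^ 2 := by
    positivity
  linarith

theorem continuous_v0 (α ν U A : ℝ → ℝ → ℝ) (t θ : ℝ) : Continuous (v0 α ν U A t θ) := by
  unfold v0
  fun_prop

/-- The energy density dominates the first momentum density. -/
theorem sqrt_mul_integral_le_integral_v0 {α ν U A : ℝ → ℝ → ℝ} {t θ : ℝ} (hα : 0 ≤ α t θ)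
    {g : V3 → ℝ} (hg : Continuous g) (hg0 : ∀ v, 0 ≤ g v) {R : ℝ}
    (hR : ∀ v, R < ‖v‖ → g v = 0) :
    Real.sqrt (α t θ) * ∫ v : V3, g v * |v.1| ≤ ∫ v : V3, g v * |v0 α ν U A t θ v| := by
  have hgc : HasCompactSupport g :=
    HasCompactSupport.intro (isCompact_closedBall (0 : V3) R) fun v hv => hR v (by simpa using hv)
  have hi : ∀ w : V3 → ℝ, Continuous w → Integrable (fun v => g v * w v) := fun w hw =>
    (hg.mul hw).integrable_of_hasCompactSupport hgc.mul_right
  rw [← integral_const_mul]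
  refine integral_mono ((hi _ (by fun_prop)).const_mul _) (hi _ (continuous_v0 α ν U A t θ).abs)
    fun v => ?_
  have h := mul_le_mul_of_nonneg_left
    (sqrt_mul_abs_le_abs_v0 (ν := ν) (U := U) (A := A) hα v) (hg0 v)
  calc Real.sqrt (α t θ) * (g v * |v.1|) = g v * (Real.sqrt (α t θ) * |v.1|) := by ring
    _ ≤ _ := h

theorem continuousOn_sInf_image_Icc {α : ℝ → ℝ → ℝ} {s : Set ℝ} {a b : ℝ}
    (hα : ContinuousOn (fun p : ℝ × ℝ => α p.1 p.2) (s ×ˢ (univ : Set ℝ))) :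
    ContinuousOn (fun t => sInf ((fun θ => α t θ) '' Icc a b)) s := by
  rw [continuousOn_iff_continuous_domRestrict]
  refine isCompact_Icc.continuous_sInf (f := fun (t : s) θ => α t θ) ?_
  exact hα.comp_continuous (f := fun p : s × ℝ => ((p.1 : ℝ), p.2)) (by fun_prop)
    fun p => ⟨p.1.2, mem_univ _⟩

theorem AntitoneOn.le_of_tendsto_nhdsGT {E : ℝ → ℝ} {a b l t : ℝ} (hE : AntitoneOn E (Ioc a b))
    (hl : Filter.Tendsto E (nhdsWithin a (Ioi a)) (nhds l)) (ht : t ∈ Ioc a b) : E t ≤ l := by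
  refine ge_of_tendsto hl ?_
  filter_upwards [Ioo_mem_nhdsGT ht.1] with s hs
  exact hE ⟨hs.1, hs.2.le.trans ht.2⟩ ht hs.2.le

theorem min_alpha_bounded
    (tp ti : ℝ) (htp : 0 < tp) (hti : tp < ti)
    (U A ν α J K : ℝ → ℝ → ℝ) (f : ℝ → ℝ → V3 → ℝ)
    (hUsm : ContDiffOn ℝ (⊤ : ℕ∞) (fun p : ℝ × ℝ => U p.1 p.2) (Ioc tp ti ×ˢ (univ : Set ℝ)))
    (hAsm : ContDiffOn ℝ (⊤ : ℕ∞) (fun p : ℝ × ℝ => A p.1 p.2) (Ioc tp ti ×ˢ (univ : Set ℝ)))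
    (hνsm : ContDiffOn ℝ (⊤ : ℕ∞) (fun p : ℝ × ℝ => ν p.1 p.2) (Ioc tp ti ×ˢ (univ : Set ℝ)))
    (hαsm : ContDiffOn ℝ (⊤ : ℕ∞) (fun p : ℝ × ℝ => α p.1 p.2) (Ioc tp ti ×ˢ (univ : Set ℝ)))
    (hJsm : ContDiffOn ℝ (⊤ : ℕ∞) (fun p : ℝ × ℝ => J p.1 p.2) (Ioc tp ti ×ˢ (univ : Set ℝ)))
    (hKsm : ContDiffOn ℝ (⊤ : ℕ∞) (fun p : ℝ × ℝ => K p.1 p.2) (Ioc tp ti ×ˢ (univ : Set ℝ)))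
    (hfsm : ContDiffOn ℝ (⊤ : ℕ∞) (fun p : ℝ × ℝ × V3 => f p.1 p.2.1 p.2.2) (Ioc tp ti ×ˢ (univ : Set (ℝ × V3))))
    (hUper : ∀ t θ, U t (θ + 1) = U t θ)
    (hAper : ∀ t θ, A t (θ + 1) = A t θ)
    (hνper : ∀ t θ, ν t (θ + 1) = ν t θ)
    (hαper : ∀ t θ, α t (θ + 1) = α t θ)
    (hJper : ∀ t θ, J t (θ + 1) = J t θ)
    (hKper : ∀ t θ, K t (θ + 1) = K t θ)
    (hfper : ∀ t θ v, f t (θ + 1) v = f t θ v)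
    (hαpos : ∀ t ∈ Ioc tp ti, ∀ θ : ℝ, 0 < α t θ)
    (hfnn : ∀ t ∈ Ioc tp ti, ∀ (θ : ℝ) (v : V3), 0 ≤ f t θ v)
    (hfsupp : ∀ t ∈ Ioc tp ti, ∃ R : ℝ, ∀ (θ : ℝ) (v : V3), R < ‖v‖ → f t θ v = 0)
    (hnut :
      ∀ t ∈ Ioc tp ti, ∀ θ : ℝ,
      (pt ν t θ)
        = t * ((pt U t θ) ^ 2 + α t θ * (pθ U t θ) ^ 2
              + Real.exp (4 * U t θ) / (4 * t ^ 2) * ((pt A t θ) ^ 2 + α t θ * (pθ A t θ) ^ 2))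
          + α t θ * Real.exp (2 * ν t θ - 4 * U t θ) / (4 * t) * J t θ ^ 2
          + α t θ * Real.exp (2 * ν t θ) / (4 * t ^ 3) * (K t θ - A t θ * J t θ) ^ 2
          + Real.sqrt (α t θ) * ∫ v : V3, f t θ v * |v0 α ν U A t θ v|)
    (Ep C₃ : ℝ)
    (hEmono : AntitoneOn (Etilde ν α) (Ioc tp ti))
    (hElim : Filter.Tendsto (Etilde ν α) (nhdsWithin tp (Ioi tp)) (nhds Ep))
    (hC₃ : 0 < C₃)
    (hlow : ∀ t ∈ Ioc tp ti, C₃ < ∫ θ in (0:ℝ)..1, ∫ v : V3, f t θ v * |v.1|) :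
    ∀ t ∈ Ioc tp ti, sInf ((fun θ => α t θ) '' Icc (0:ℝ) 1) ≤ (ti * Ep / C₃) ^ 2 := by
  have hαc : ∀ t ∈ Ioc tp ti, Continuous (fun θ => α t θ) := fun t ht =>
    hαsm.continuousOn.comp_continuous (f := fun θ : ℝ => (t, θ)) (by fun_prop)
      fun θ => ⟨ht, mem_univ θ⟩
  have interior : ∀ t ∈ Ioo tp ti,
      sInf ((fun θ => α t θ) '' Icc (0 : ℝ) 1) ≤ (ti * Ep / C₃) ^ 2 := by
    intro t ht
    have ht' : t ∈ Ioc tp ti := Ioo_subset_Ioc_self ht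
    have ht0 : 0 < t := htp.trans ht.1
    set m := sInf ((fun θ => α t θ) '' Icc (0 : ℝ) 1) with hm
    have hmle : ∀ θ ∈ Icc (0 : ℝ) 1, m ≤ α t θ := fun θ hθ =>
      csInf_le ⟨0, by rintro _ ⟨x, -, rfl⟩; exact (hαpos t ht' x).le⟩ (mem_image_of_mem _ hθ)
    have hm0 : 0 ≤ m := Real.sInf_nonneg (by rintro _ ⟨x, -, rfl⟩; exact (hαpos t ht' x).le)
    obtain ⟨R, hR⟩ := hfsupp t ht'
    have hpoint : ∀ θ ∈ Icc (0 : ℝ) 1,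
        Real.sqrt m / t * (∫ v : V3, f t θ v * |v.1|) ≤ pt ν t θ / (Real.sqrt (α t θ) * t) := by
      intro θ hθ
      have hα0 := hαpos t ht' θ
      have hs := Real.sqrt_pos.mpr hα0
      have hfc : Continuous (f t θ) :=
        hfsm.continuousOn.comp_continuous (f := fun v : V3 => (t, θ, v)) (by fun_prop)
          fun v => ⟨ht', mem_univ _⟩
      have hI0 : 0 ≤ ∫ v : V3, f t θ v * |v.1| :=
        integral_nonneg fun v => mul_nonneg (hfnn t ht' θ v) (abs_nonneg _)
      have hI := sqrt_mul_integral_le_integral_v0 (ν := ν) (U := U) (A := A) hα0.le hfc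
        (hfnn t ht' θ) (hR θ)
      have hmI := (mul_le_mul_of_nonneg_right (Real.sqrt_le_sqrt (hmle θ hθ)) hI0).trans hI
      have hν : Real.sqrt (α t θ) * (∫ v : V3, f t θ v * |v0 α ν U A t θ v|) ≤ pt ν t θ := by
        rw [hnut t ht' θ]
        refine le_add_of_nonneg_left ?_
        positivity
      rw [le_div_iff₀ (by positivity)]
      calc Real.sqrt m / t * (∫ v : V3, f t θ v * |v.1|) * (Real.sqrt (α t θ) * t)
          = Real.sqrt (α t θ) * (Real.sqrt m * ∫ v : V3, f t θ v * |v.1|) := by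
            field_simp
        _ ≤ Real.sqrt (α t θ) * ∫ v : V3, f t θ v * |v0 α ν U A t θ v| := by gcongr
        _ ≤ pt ν t θ := hν
    have hint : IntervalIntegrable (fun θ => ∫ v : V3, f t θ v * |v.1|) volume 0 1 := by
      by_contra h
      have := hlow t ht'
      rw [intervalIntegral.integral_undef h] at this
      linarith
    have hEint : IntervalIntegrable (fun θ => pt ν t θ / (Real.sqrt (α t θ) * t)) volume 0 1 := by
      refine Continuous.intervalIntegrable ?_ 0 1
      exact (continuous_pt_of_contDiffOn hνsm ht).div
        ((hαc t ht').sqrt.mul continuous_const)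
        fun θ => (mul_pos (Real.sqrt_pos.mpr (hαpos t ht' θ)) ht0).ne'
    have hE : Real.sqrt m / t * C₃ ≤ Etilde ν α t := by
      calc Real.sqrt m / t * C₃
          ≤ Real.sqrt m / t * ∫ θ in (0 : ℝ)..1, ∫ v : V3, f t θ v * |v.1| := by
            gcongr
            exact (hlow t ht').le
        _ = ∫ θ in (0 : ℝ)..1, Real.sqrt m / t * ∫ v : V3, f t θ v * |v.1| :=
            (intervalIntegral.integral_const_mul _ _).symm
        _ ≤ Etilde ν α t :=
            intervalIntegral.integral_mono_on zero_le_one (hint.const_mul _) hEint hpoint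
    have hEp : Real.sqrt m / t * C₃ ≤ Ep := hE.trans (hEmono.le_of_tendsto_nhdsGT hElim ht')
    have hEp0 : 0 ≤ Ep := le_trans (by positivity) hEp
    have hsm : Real.sqrt m ≤ ti * Ep / C₃ := by
      rw [le_div_iff₀ hC₃]
      calc Real.sqrt m * C₃ = t * (Real.sqrt m / t * C₃) := by field_simp
        _ ≤ t * Ep := by gcongr
        _ ≤ ti * Ep := by gcongr; exact ht.2.le
    exact (Real.sqrt_le_iff.mp hsm).2
  intro t ht
  rcases ht.2.lt_or_eq with h | rfl
  · exact interior t ⟨ht.1, h⟩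
  · have hne : (nhdsWithin t (Ioo tp t)).NeBot := right_nhdsWithin_Ioo_neBot hti
    exact le_of_tendsto ((continuousOn_sInf_image_Icc hαsm.continuousOn t ht).mono
      Ioo_subset_Ioc_self) (Filter.eventually_of_mem self_mem_nhdsWithin interior)
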